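/- The number of n-cycles in S_n whose descent set equals J (where n ∈ J by convention) is Σ_{K ⊆ J} (-1)^{|J|-|K|} M(C(K)), where M(r_1,...,r_a) = (1/n) Σ_{d | gcd(n, r_1,...,r_a)} μ(d)·(n/d)!/((r_1/d)!···(r_a/d)!) and C(K) is the composition of n determined by K. -/

import Mathlib

/-- The value of `π` at the (0-indexed) position `i`, extended by `0` outside the range. -/
def permVal (n : ℕ) (π : Equiv.Perm (Fin n)) (i : ℕ) : ℕ :=
  if h : i < n then (π ⟨i, h⟩ : ℕ) else 0

/-- The descent set of `π ∈ S_n` (with the convention that `n` is always a descent). -/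
def descentSet (n : ℕ) (π : Equiv.Perm (Fin n)) : Finset ℕ :=
  insert n ((Finset.Ico 1 n).filter fun i => permVal n π i < permVal n π (i - 1))

/-- The full cycle type of a permutation: the multiset of the lengths of all its
cycles, including fixed points as cycles of length 1. -/
def fullCycleType (n : ℕ) (π : Equiv.Perm (Fin n)) : Multiset ℕ :=
  π.cycleType + Multiset.replicate (n - π.cycleType.sum) 1

/-- `M(r₁,…,r_a) = (1/m) ∑_{d | gcd(m,r₁,…,r_a)} μ(d) (m/d)! / ∏ (rᵢ/d)!`,
where `m = r₁ + ⋯ + r_a`: the number of primitive necklaces with `rᵢ` copies of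
the letter `i`. -/
def Mq (L : List ℕ) : ℚ :=
  (1 / (L.sum : ℚ)) * ∑ d ∈ (Nat.gcd L.sum (L.foldr Nat.gcd 0)).divisors,
    (ArithmeticFunction.moebius d : ℚ) * (Nat.factorial (L.sum / d) : ℚ) /
      (L.map fun s => (Nat.factorial (s / d) : ℚ)).prod

/-- The composition `C(K) = (k₁ - k₀, k₂ - k₁, …, k_d - k_{d-1})` (with `k₀ = 0`)
of a finite set `K = {k₁ < k₂ < ⋯ < k_d}`. -/
def comp (K : Finset ℕ) : List ℕ :=
  List.zipWith (fun u v => u - v) (K.sort (· ≤ ·)) (0 :: K.sort (· ≤ ·))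

open Finset in
theorem exists_perm_comp_eq_of_card_fiber_eq {α β ι : Type*} [Fintype α] [Fintype β] [DecidableEq ι]
    (v : α → ι) (w : β → ι)
    (h : ∀ i, #{x | v x = i} = #{y | w y = i}) : ∃ e : α ≃ β, w ∘ e = v := by
  have e (i : ι) : {x // v x = i} ≃ {y // w y = i} :=
    Fintype.equivOfCardEq (by simpa [Fintype.card_subtype] using h i)
  refine ⟨(Equiv.sigmaFiberEquiv v).symm.trans
    ((Equiv.sigmaCongrRight e).trans (Equiv.sigmaFiberEquiv w)), ?_⟩
  ext x
  exact (e (v x) ⟨x, rfl⟩).2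

open Finset in
theorem card_fiber_comp_equiv {α β ι : Type*} [Fintype α] [Fintype β] [DecidableEq ι]
    (w : β → ι) (e : α ≃ β) (i : ι) : #{x | w (e x) = i} = #{y | w y = i} :=
  card_equiv e (by simp)

open Finset Nat in
theorem card_functions_with_fibers_mul_prod_factorial {α ι : Type*} [Fintype α] [DecidableEq α]
    [Fintype ι] [DecidableEq ι] (s : ι → ℕ) (hs : ∑ i, s i = Fintype.card α) :
    #{v : α → ι | ∀ i, #{x | v x = i} = s i} * ∏ i, (s i)! = (Fintype.card α)! := by
  obtain ⟨v₀, hv₀⟩ : ∃ v : α → ι, ∀ i, #{x | v x = i} = s i := by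
    have e : α ≃ Σ i, Fin (s i) := Fintype.equivOfCardEq (by simp [hs])
    refine ⟨fun x => (e x).1, fun i => ?_⟩
    rw [card_fiber_comp_equiv (fun y : Σ i, Fin (s i) => y.1) e i, ← Fintype.card_subtype,
      Fintype.card_congr (Equiv.sigmaSubtype i), Fintype.card_fin]
  rw [← Fintype.card_perm, ← Finset.card_univ (α := Equiv.Perm α),
    card_eq_sum_card_fiberwise (f := fun g : Equiv.Perm α => v₀ ∘ g)
      (t := {v : α → ι | ∀ i, #{x | v x = i} = s i})]
  · rw [← smul_eq_mul, ← sum_const]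
    refine sum_congr rfl fun v hv => ?_
    simp only [mem_filter, mem_univ, true_and] at hv
    obtain ⟨e, he⟩ := exists_perm_comp_eq_of_card_fiber_eq v v₀ (fun i => by rw [hv, hv₀])
    have := DomMulAct.stabilizer_card v₀
    rw [Fintype.card_subtype] at this
    simp only [Fintype.card_subtype, hv₀] at this
    rw [← this]
    refine card_equiv (Equiv.mulRight e) fun g => ?_
    simp only [mem_filter, mem_univ, true_and, ← he, Equiv.coe_mulRight, Equiv.Perm.coe_mul]
    rw [← Function.comp_assoc]
    exact (e.surjective.injective_comp_right.eq_iff).symm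
  · intro g _
    simp only [coe_filter, mem_univ, true_and, Set.mem_ofPred_eq, Function.comp_apply]
    intro i
    rw [card_fiber_comp_equiv v₀ g i, hv₀]

/-- Cyclic shift of a word indexed by `ZMod n`. -/
def cyclicShift (n : ℕ) (A : Type*) (w : ZMod n → A) : ZMod n → A := fun k => w (k + 1)

theorem cyclicShift_iterate {n : ℕ} {A : Type*} (w : ZMod n → A) (m : ℕ) (k : ZMod n) :
    (cyclicShift n A)^[m] w k = w (k + m) := by
  induction m generalizing w with
  | zero => simp
  | succ m ih =>
    rw [Function.iterate_succ_apply, ih, cyclicShift, Nat.cast_succ, add_assoc]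

theorem sum_moebius_divisors_filter_periodic {n : ℕ} (hn : 0 < n) {α : Type*} (T : α → α) (w : α)
    [DecidableEq α] (hT : T^[n] w = w) :
    (∑ d ∈ n.divisors with T^[n / d] w = w, ArithmeticFunction.moebius d) =
      if Function.minimalPeriod T w = n then 1 else 0 := by
  have hp : Function.IsPeriodicPt T n w := hT
  have hdvd := hp.minimalPeriod_dvd
  set p := Function.minimalPeriod T w with hpdef
  obtain ⟨q, hq⟩ := hdvd
  have hp0 : 0 < p := Nat.pos_of_mul_pos_right (hq ▸ hn)
  have hq0 : 0 < q := Nat.pos_of_mul_pos_left (hq ▸ hn)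
  have hset : n.divisors.filter (fun d => T^[n / d] w = w) = q.divisors := by
    ext d
    simp only [Finset.mem_filter, Nat.mem_divisors]
    have : T^[n / d] w = w ↔ p ∣ n / d := Function.isPeriodicPt_iff_minimalPeriod_dvd
    rw [this]
    constructor
    · rintro ⟨⟨⟨e, he⟩, _⟩, h⟩
      have hd0 : 0 < d := Nat.pos_of_mul_pos_right (he ▸ hn)
      rw [he, Nat.mul_div_cancel_left _ hd0] at h
      obtain ⟨t, rfl⟩ := h
      refine ⟨⟨t, ?_⟩, hq0.ne'⟩
      apply Nat.eq_of_mul_eq_mul_left hp0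
      rw [← hq, he]; ring
    · rintro ⟨⟨t, rfl⟩, _⟩
      have hd0 : 0 < d := Nat.pos_of_mul_pos_right hq0
      refine ⟨⟨⟨p * t, by rw [hq]; ring⟩, hn.ne'⟩, t, ?_⟩
      rw [hq, mul_left_comm, Nat.mul_div_cancel_left _ hd0]
  rw [hset, ← ArithmeticFunction.coe_mul_zeta_apply, ArithmeticFunction.moebius_mul_coe_zeta,
    ArithmeticFunction.one_apply]
  refine if_congr ?_ rfl rfl
  rw [hq]
  constructor
  · rintro rfl; simp
  · intro h
    exact Nat.eq_of_mul_eq_mul_left hp0 (by omega)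

open Finset in
theorem card_castHom_fiber {m n d : ℕ} [NeZero n] [NeZero m] (h : n = m * d) (y : ZMod m) :
    #{x : ZMod n | ZMod.castHom (Dvd.intro d h.symm) (ZMod m) x = y} = d := by
  set φ := ZMod.castHom (Dvd.intro d h.symm) (ZMod m) with hφ
  have hsurj : Function.Surjective φ := ZMod.castHom_surjective _
  have key := card_eq_sum_card_fiberwise (s := (univ : Finset (ZMod n))) (t := univ) (f := φ)
    (fun _ _ => mem_coe.2 (mem_univ _))
  rw [sum_congr rfl (fun b _ => AddMonoidHom.card_fiber_eq_of_mem_range φ (hsurj b) (hsurj y)),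
    sum_const, smul_eq_mul, card_univ, card_univ, ZMod.card, ZMod.card] at key
  exact (Nat.eq_of_mul_eq_mul_left (NeZero.pos m) (h.symm.trans key)).symm

open Finset in
theorem card_periodic_words {m n d a : ℕ} [NeZero n] [NeZero m] [NeZero d] (h : n = m * d)
    (r : Fin a → ℕ) :
    #{w : ZMod n → Fin a | (∀ i, #{x | w x = i} = r i) ∧ (cyclicShift n (Fin a))^[m] w = w} =
    #{v : ZMod m → Fin a | ∀ i, d * #{x | v x = i} = r i} := by
  symm
  have hdvd : m ∣ n := Dvd.intro d h.symm
  set φ := ZMod.castHom hdvd (ZMod m) with hφ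
  have hsurj : Function.Surjective φ := ZMod.castHom_surjective _
  have hfib (v : ZMod m → Fin a) (i : Fin a) : #{x | v (φ x) = i} = d * #{x | v x = i} := by
    rw [card_eq_sum_card_fiberwise (f := φ) (t := {x | v x = i})]
    · rw [mul_comm, ← smul_eq_mul, ← sum_const]
      refine sum_congr rfl fun y hy => ?_
      rw [← card_castHom_fiber h y, filter_filter]
      congr 1
      ext x
      simp only [mem_filter, mem_univ, true_and] at hy ⊢
      constructor
      · exact fun h => h.2
      · rintro rfl
        exact ⟨hy, rfl⟩
    · intro x hx
      simpa using hx
  refine card_bij (fun v _ => v ∘ φ) ?_ ?_ ?_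
  · intro v hv
    simp only [mem_filter, mem_univ, true_and, Function.comp_apply] at hv ⊢
    refine ⟨fun i => by rw [hfib, hv], ?_⟩
    ext x
    rw [cyclicShift_iterate]
    simp
  · intro v _ v' _ hvv
    exact hsurj.injective_comp_right hvv
  · intro w hw
    simp only [mem_filter, mem_univ, true_and] at hw ⊢
    obtain ⟨hw, hper⟩ := hw
    have hP : Function.Periodic (fun i : ℕ => w i) m := by
      intro i
      have := congrFun hper (i : ZMod n)
      rw [cyclicShift_iterate] at this
      simpa using this
    have hfac : (fun y : ZMod m => w (y.val : ZMod n)) ∘ φ = w := by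
      ext x
      have h1 := hP.map_mod_nat x.val
      simp only [ZMod.natCast_val, ZMod.cast_id', id] at h1
      have h2 : (φ x).val = x.val % m := by
        rw [hφ, ZMod.castHom_apply, ZMod.cast_eq_val, ZMod.val_natCast]
      rw [Function.comp_apply, h2, h1]
    refine ⟨fun y => w (y.val : ZMod n), fun i => ?_, hfac⟩
    rw [← hfib, ← hw]
    congr 1
    ext x
    simp only [mem_filter, mem_univ, true_and]
    rw [← congrFun hfac x]; rfl

open Finset in
theorem card_primitive_words {n a : ℕ} [NeZero n] (r : Fin a → ℕ) (hr : ∑ i, r i = n) :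
    (#{w : ZMod n → Fin a | (∀ i, #{x | w x = i} = r i) ∧
      Function.minimalPeriod (cyclicShift n (Fin a)) w = n} : ℚ) =
    ∑ d ∈ n.divisors with ∀ i, d ∣ r i, (ArithmeticFunction.moebius d : ℚ) *
      ((n / d).factorial : ℚ) / ∏ i, ((r i / d).factorial : ℚ) := by
  have hn : 0 < n := NeZero.pos n
  rw [← filter_filter, card_filter]
  push_cast
  have h1 (w : ZMod n → Fin a) :
      (if Function.minimalPeriod (cyclicShift n (Fin a)) w = n then (1 : ℚ) else 0) =
      ∑ d ∈ n.divisors, if (cyclicShift n (Fin a))^[n / d] w = w then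
        (ArithmeticFunction.moebius d : ℚ) else 0 := by
    have := sum_moebius_divisors_filter_periodic hn (cyclicShift n (Fin a)) w
      (by ext x; rw [cyclicShift_iterate]; simp)
    rw [← sum_filter]
    exact_mod_cast this.symm
  simp_rw [h1]
  rw [sum_comm, sum_filter]
  refine sum_congr rfl fun d hd => ?_
  obtain ⟨⟨m, hm⟩, _⟩ := Nat.mem_divisors.1 hd
  have hd0 : 0 < d := Nat.pos_of_mem_divisors hd
  have hm0 : 0 < m := Nat.pos_of_mul_pos_left (hm ▸ hn)
  have : NeZero d := ⟨hd0.ne'⟩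
  have : NeZero m := ⟨hm0.ne'⟩
  have hnd : n / d = m := by rw [hm, Nat.mul_div_cancel_left _ hd0]
  rw [hnd, ← sum_filter, filter_filter, sum_const, card_periodic_words (hm.trans (mul_comm _ _)),
    nsmul_eq_mul]
  split_ifs with hdr
  · have hsum : ∑ i, r i / d = Fintype.card (ZMod m) := by
      rw [ZMod.card]
      apply Nat.eq_of_mul_eq_mul_left hd0
      rw [← hm, mul_sum, ← hr]
      exact sum_congr rfl fun i _ => Nat.mul_div_cancel' (hdr i)
    have h2 : #{v : ZMod m → Fin a | ∀ i, #{x | v x = i} = r i / d} * ∏ i, (r i / d).factorial =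
        m.factorial := by
      convert card_functions_with_fibers_mul_prod_factorial (α := ZMod m) _ hsum
      rw [ZMod.card]
    have h3 : ∀ v : ZMod m → Fin a, (∀ i, d * #{x | v x = i} = r i) ↔
        ∀ i, #{x | v x = i} = r i / d := fun v => forall_congr' fun i => by
      rw [eq_comm, Nat.eq_div_iff_mul_eq_left hd0.ne' (hdr i), mul_comm]
    rw [filter_congr fun v _ => h3 v, eq_div_iff (prod_ne_zero_iff.2 fun i _ => by positivity),
      ← h2]
    push_cast
    ring
  · rw [filter_false_of_mem]
    · simp
    · intro v _ hv
      exact hdr fun i => ⟨_, (hv i).symm⟩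

theorem cyclicShift_isPeriodicPt {n : ℕ} {A : Type*} (w : ZMod n → A) :
    Function.IsPeriodicPt (cyclicShift n A) n w := by
  ext x
  rw [cyclicShift_iterate]
  simp

/-- The infinite periodic sequence of letters of a cyclic word read from position `k`. -/
def readFrom {n : ℕ} {A : Type*} (w : ZMod n → A) (k : ZMod n) : Lex (ℕ → A) :=
  toLex fun j => w (k + j)

theorem readFrom_eq_iff {n : ℕ} [NeZero n] {A : Type*} (w : ZMod n → A) (k l : ZMod n) :
    readFrom w k = readFrom w l ↔ ∀ x, w (k + x) = w (l + x) := by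
  constructor
  · intro h x
    have := congrFun (toLex.injective h) x.val
    simpa using this
  · intro h
    exact congrArg toLex (funext fun j => h j)

theorem minimalPeriod_cyclicShift_eq_iff {n : ℕ} [NeZero n] {A : Type*} (w : ZMod n → A) :
    Function.minimalPeriod (cyclicShift n A) w = n ↔ Function.Injective (readFrom w) := by
  constructor
  · intro hp k l hkl
    rw [readFrom_eq_iff] at hkl
    have h : Function.IsPeriodicPt (cyclicShift n A) (l - k).val w := by
      ext x
      rw [cyclicShift_iterate, ZMod.natCast_zmod_val]
      have := hkl (x - k)
      rw [add_sub_cancel] at this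
      rw [this]
      congr 1
      ring
    rw [Function.isPeriodicPt_iff_minimalPeriod_dvd, hp] at h
    have h0 : (l - k).val = 0 := Nat.eq_zero_of_dvd_of_lt h (ZMod.val_lt _)
    rw [ZMod.val_eq_zero, sub_eq_zero] at h0
    exact h0.symm
  · intro hinj
    refine Nat.dvd_antisymm (cyclicShift_isPeriodicPt w).minimalPeriod_dvd ?_
    rw [← ZMod.natCast_eq_zero_iff]
    apply hinj
    rw [readFrom_eq_iff]
    intro x
    have := congrFun (Function.isPeriodicPt_minimalPeriod (cyclicShift n A) w) x
    rw [cyclicShift_iterate] at this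
    rw [add_comm, this, zero_add]

theorem readFrom_succ_lt {n : ℕ} {A : Type*} [LinearOrder A] (w : ZMod n → A) {k l : ZMod n}
    (h : readFrom w k < readFrom w l) (hw : w k = w l) :
    readFrom w (k + 1) < readFrom w (l + 1) := by
  obtain ⟨j, hj, hlt⟩ := h
  change ∀ i < j, w (k + i) = w (l + i) at hj
  change w (k + j) < w (l + j) at hlt
  rcases j with _ | j
  · simp [hw] at hlt
  · refine ⟨j, fun i hi => ?_, ?_⟩
    · have := hj (i + 1) (by omega)
      push_cast at this
      change w (k + 1 + i) = w (l + 1 + i)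
      rwa [add_assoc, add_assoc, add_comm 1]
    · change w (k + 1 + j) < w (l + 1 + j)
      push_cast at hlt
      rwa [add_assoc, add_assoc, add_comm 1]

theorem le_of_readFrom_lt {n : ℕ} {A : Type*} [LinearOrder A] (w : ZMod n → A) {k l : ZMod n}
    (h : readFrom w k < readFrom w l) : w k ≤ w l := by
  obtain ⟨j, hj, hlt⟩ := h
  change ∀ i < j, w (k + i) = w (l + i) at hj
  change w (k + j) < w (l + j) at hlt
  rcases j with _ | j
  · simpa using hlt.le
  · simpa using (hj 0 (by omega)).le

/-- `ρ` numbers `ℤ/n` in such a way that the rotation `k ↦ k + 1`, transported to `Fin n`,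
is increasing on the fibers of `f`. -/
def IsFiberwiseIncreasing {n a : ℕ} (f : Fin n → Fin a) (ρ : ZMod n ≃ Fin n) : Prop :=
  ∀ k l, ρ k < ρ l → f (ρ k) = f (ρ l) → ρ (k + 1) < ρ (l + 1)

theorem IsFiberwiseIncreasing.add_lt_add {n a : ℕ} {f : Fin n → Fin a} {ρ : ZMod n ≃ Fin n}
    (hρ : IsFiberwiseIncreasing f ρ) {k l : ZMod n} (h : ρ k < ρ l) (j : ℕ)
    (hj : ∀ i < j, f (ρ (k + i)) = f (ρ (l + i))) : ρ (k + j) < ρ (l + j) := by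
  induction j with
  | zero => simpa using h
  | succ j ih =>
    have := hρ _ _ (ih fun i hi => hj i (by omega)) (hj j (by omega))
    push_cast
    rwa [← add_assoc, ← add_assoc]

theorem IsFiberwiseIncreasing.readFrom_lt {n a : ℕ} [NeZero n] {f : Fin n → Fin a}
    (hf : Monotone f) {ρ : ZMod n ≃ Fin n}
    (hρ : IsFiberwiseIncreasing f ρ) {k l : ZMod n} (h : ρ k < ρ l) :
    readFrom (f ∘ ρ) k < readFrom (f ∘ ρ) l := by
  classical
  by_cases hex : ∃ j : ℕ, f (ρ (k + j)) ≠ f (ρ (l + j))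
  · have hmin (i : ℕ) (hi : i < Nat.find hex) : f (ρ (k + i)) = f (ρ (l + i)) :=
      not_not.1 (Nat.find_min hex hi)
    exact ⟨Nat.find hex, hmin,
      lt_of_le_of_ne (hf (hρ.add_lt_add h _ hmin).le) (Nat.find_spec hex)⟩
  · push Not at hex
    have hlt (x : ZMod n) : ρ (k + x) < ρ (l + x) := by
      simpa using hρ.add_lt_add h x.val fun i _ => hex i
    have hmono : StrictMono fun i : ℕ => ρ (k + i * (l - k)) := by
      refine strictMono_nat_of_lt_succ fun i => ?_
      have hstep : k + ((i + 1 : ℕ) : ZMod n) * (l - k) = l + i * (l - k) := by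
        push_cast
        ring
      rw [hstep]
      exact hlt _
    have := hmono (NeZero.pos n)
    simp at this

theorem IsFiberwiseIncreasing.lt_iff {n a : ℕ} [NeZero n] {f : Fin n → Fin a}
    (hf : Monotone f) {ρ : ZMod n ≃ Fin n} (hρ : IsFiberwiseIncreasing f ρ) (k l : ZMod n) :
    ρ k < ρ l ↔ readFrom (f ∘ ρ) k < readFrom (f ∘ ρ) l := by
  refine ⟨hρ.readFrom_lt hf, fun h => ?_⟩
  rcases lt_trichotomy (ρ k) (ρ l) with h1 | h1 | h1
  · exact h1
  · rw [ρ.injective h1] at h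
    exact (lt_irrefl _ h).elim
  · exact (lt_asymm h (hρ.readFrom_lt hf h1)).elim

theorem IsFiberwiseIncreasing.readFrom_injective {n a : ℕ} [NeZero n] {f : Fin n → Fin a}
    (hf : Monotone f) {ρ : ZMod n ≃ Fin n} (hρ : IsFiberwiseIncreasing f ρ) :
    Function.Injective (readFrom (f ∘ ρ)) := by
  intro k l hkl
  by_contra hne
  rcases lt_or_gt_of_ne (fun h => hne (ρ.injective h)) with h | h
  · exact (hρ.readFrom_lt hf h).ne hkl
  · exact (hρ.readFrom_lt hf h).ne' hkl

theorem exists_numbering_of_injective {n : ℕ} [NeZero n] {α : Type*} [LinearOrder α]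
    (S : ZMod n → α) (hS : Function.Injective S) :
    ∃ ρ : ZMod n ≃ Fin n, ∀ k l, ρ k < ρ l ↔ S k < S l := by
  classical
  have e := Fintype.orderIsoFinOfCardEq (Set.range S) (k := n) (by
    rw [Set.card_range_of_injective hS, ZMod.card])
  refine ⟨(Equiv.ofInjective S hS).trans e.symm.toEquiv, fun k l => ?_⟩
  rw [Equiv.trans_apply, Equiv.trans_apply]
  exact e.symm.lt_iff_lt

open Finset in
theorem card_isFiberwiseIncreasing {n a : ℕ} [NeZero n] (f : Fin n → Fin a) (hf : Monotone f) :
    Nat.card {ρ : ZMod n ≃ Fin n // IsFiberwiseIncreasing f ρ} =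
    #{w : ZMod n → Fin a | (∀ i, #{x | w x = i} = #{x | f x = i}) ∧
      Function.minimalPeriod (cyclicShift n (Fin a)) w = n} := by
  rw [← Fintype.card_subtype, ← Nat.card_eq_fintype_card]
  refine Nat.card_congr (Equiv.ofBijective
    (fun ρ => ⟨f ∘ ρ.1, fun i => card_fiber_comp_equiv f ρ.1 i,
      (minimalPeriod_cyclicShift_eq_iff _).2 (ρ.2.readFrom_injective hf)⟩) ⟨?_, ?_⟩)
  · rintro ⟨ρ, hρ⟩ ⟨ρ', hρ'⟩ h
    have h : f ∘ ρ = f ∘ ρ' := congrArg Subtype.val h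
    have hlt (k l) : ρ k < ρ l ↔ ρ' k < ρ' l := by
      rw [hρ.lt_iff hf, hρ'.lt_iff hf, h]
    have hm : StrictMono (ρ.symm.trans ρ') := fun i j hij => by
      rw [Equiv.trans_apply, Equiv.trans_apply, ← hlt]
      simpa using hij
    have h1 := Subsingleton.elim (hm.orderIsoOfSurjective _ (ρ.symm.trans ρ').surjective)
      (OrderIso.refl (Fin n))
    refine Subtype.ext (Equiv.ext fun k => ?_)
    have : ρ' (ρ.symm (ρ k)) = ρ k := DFunLike.congr_fun h1 (ρ k)
    rw [← this, Equiv.symm_apply_apply]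
  · rintro ⟨w, hw, hp⟩
    obtain ⟨e, he⟩ := exists_perm_comp_eq_of_card_fiber_eq w f hw
    obtain ⟨ρ, hρ⟩ := exists_numbering_of_injective _ ((minimalPeriod_cyclicShift_eq_iff w).1 hp)
    have hmono : Monotone (f ∘ (ρ.symm.trans e)) := by
      rw [Equiv.coe_trans, ← Function.comp_assoc, he]
      refine monotone_iff_forall_lt.2 fun i j hij => ?_
      exact le_of_readFrom_lt w ((hρ _ _).1 (by simpa using hij))
    have h1 := Tuple.unique_monotone (f := f) (σ := Equiv.refl _) hf hmono
    have h2 : f ∘ ρ = w := by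
      ext k : 1
      have := congrFun h1 (ρ k)
      simp only [Function.comp_apply, Equiv.refl_apply, Equiv.trans_apply,
        Equiv.symm_apply_apply] at this
      rw [Function.comp_apply, this, ← he, Function.comp_apply]
    refine ⟨⟨ρ, fun k l hkl hfkl => ?_⟩, Subtype.ext h2⟩
    rw [hρ] at hkl ⊢
    refine readFrom_succ_lt w hkl ?_
    rw [← h2]
    exact hfkl

open Equiv.Perm in
theorem card_isCycleOn_fiberwise_increasing {n a : ℕ} [NeZero n] (f : Fin n → Fin a) :
    Nat.card {ρ : ZMod n ≃ Fin n // IsFiberwiseIncreasing f ρ} =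
    Nat.card {π : Equiv.Perm (Fin n) // π.IsCycleOn Set.univ ∧
      ∀ i j, i < j → f i = f j → π i < π j} * n := by
  set rot : (ZMod n ≃ Fin n) → Equiv.Perm (Fin n) :=
    fun ρ => ρ.symm.trans ((Equiv.addRight 1).trans ρ) with hrot
  have rot_apply (ρ : ZMod n ≃ Fin n) (k) : rot ρ (ρ k) = ρ (k + 1) := by simp [hrot]
  have rot_pow (ρ : ZMod n ≃ Fin n) (j : ℕ) (k) : (rot ρ ^ j) (ρ k) = ρ (k + j) := by
    induction j with
    | zero => simp
    | succ j ih =>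
      rw [pow_succ', Equiv.Perm.mul_apply, ih, rot_apply]
      push_cast
      rw [add_assoc]
  have hcycle (ρ : ZMod n ≃ Fin n) : (rot ρ).IsCycleOn Set.univ := by
    refine ⟨Set.bijOn_univ.2 (rot ρ).bijective, fun x _ y _ => ⟨(ρ.symm y - ρ.symm x).val, ?_⟩⟩
    obtain ⟨k, rfl⟩ := ρ.surjective x
    rw [zpow_natCast, rot_pow]
    simp
  rw [show ∀ c : ℕ, c * n = c * Nat.card (Fin n) by simp, ← Nat.card_prod]
  refine Nat.card_congr (Equiv.ofBijective (fun ρ => (⟨rot ρ.1, hcycle ρ.1, ?_⟩, ρ.1 0)) ⟨?_, ?_⟩)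
  · intro i j hij hfij
    obtain ⟨k, rfl⟩ := ρ.1.surjective i
    obtain ⟨l, rfl⟩ := ρ.1.surjective j
    rw [rot_apply, rot_apply]
    exact ρ.2 k l hij hfij
  · rintro ⟨ρ, hρ⟩ ⟨ρ', hρ'⟩ h
    simp only [Prod.mk.injEq, Subtype.mk.injEq] at h
    obtain ⟨h1, h2⟩ := h
    ext k
    have e1 := rot_pow ρ k.val 0
    have e2 := rot_pow ρ' k.val 0
    rw [h1, h2, e2] at e1
    simp only [zero_add, ZMod.natCast_val, ZMod.cast_id', id] at e1
    rw [e1]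
  · rintro ⟨⟨π, hπ, hinc⟩, x⟩
    have hπ' : π.IsCycleOn (Finset.univ : Finset (Fin n)) := by simpa using hπ
    have hpow (j j' : ℕ) : (π ^ j) x = (π ^ j') x ↔ (j : ZMod n) = j' := by
      rw [hπ'.pow_apply_eq_pow_apply (Finset.mem_univ x), Finset.card_univ, Fintype.card_fin,
        ZMod.natCast_eq_natCast_iff]
    have hinj : Function.Injective fun k : ZMod n => (π ^ k.val) x := by
      intro k l hkl
      simpa using (hpow _ _).1 hkl
    have hbij : Function.Bijective fun k : ZMod n => (π ^ k.val) x :=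
      (Fintype.bijective_iff_injective_and_card _).2 ⟨hinj, by rw [ZMod.card, Fintype.card_fin]⟩
    set ρ := Equiv.ofBijective _ hbij with hρdef
    have hρ (k) : ρ k = (π ^ k.val) x := rfl
    have hsucc (k) : ρ (k + 1) = π (ρ k) := by
      rw [hρ, hρ, ← Equiv.Perm.mul_apply, ← pow_succ', hpow]
      simp
    refine ⟨⟨ρ, fun k l hkl hfkl => ?_⟩, ?_⟩
    · rw [hsucc, hsucc]
      exact hinc _ _ hkl hfkl
    · refine Prod.ext (Subtype.ext (Equiv.ext fun y => ?_)) ?_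
      · obtain ⟨k, rfl⟩ := ρ.surjective y
        exact (rot_apply ρ k).trans (hsucc k)
      · simp [hρ]

theorem fullCycleType_eq_singleton_iff {n : ℕ} (hn : 0 < n) (π : Equiv.Perm (Fin n)) :
    fullCycleType n π = {n} ↔ π.IsCycleOn Set.univ := by
  rcases Nat.lt_or_ge 1 n with h1 | h1
  · have : Nontrivial (Fin n) := Fin.nontrivial_iff_two_le.2 h1
    have hiff : fullCycleType n π = {n} ↔ π.cycleType = {n} := by
      constructor
      · intro h
        have hle : π.cycleType ≤ {n} := h ▸ Multiset.le_add_right _ _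
        rcases Multiset.le_singleton.1 hle with h0 | h0
        · rw [fullCycleType, h0] at h
          have hn1 : (n : ℕ) ∈ Multiset.replicate n 1 := by
            have : n ∈ ({n} : Multiset ℕ) := Multiset.mem_singleton_self n
            rw [← h] at this
            simpa using this
          exact absurd (Multiset.eq_of_mem_replicate hn1) (by omega)
        · exact h0
      · intro h
        simp [fullCycleType, h]
    rw [hiff]
    constructor
    · intro h
      have hc : π.IsCycle := Equiv.Perm.card_cycleType_eq_one.1 (by rw [h]; simp)
      have hs := π.sum_cycleType
      rw [h, Multiset.sum_singleton] at hs
      have hu : π.support = Finset.univ :=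
        Finset.eq_univ_of_card _ (by rw [← hs, Fintype.card_fin])
      have := hc.isCycleOn
      convert this
      symm
      rw [Set.eq_univ_iff_forall]
      intro x
      exact Equiv.Perm.mem_support.1 (hu ▸ Finset.mem_univ x)
    · intro h
      have hc : π.IsCycle :=
        Equiv.Perm.isCycle_iff_exists_isCycleOn.2 ⟨_, Set.nontrivial_univ, h, fun _ _ => trivial⟩
      have hu : π.support = Finset.univ := by
        rw [Finset.eq_univ_iff_forall]
        exact fun x => Equiv.Perm.mem_support.2 (h.apply_ne Set.nontrivial_univ (Set.mem_univ x))
      rw [hc.cycleType, hu]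
      simp
  · obtain rfl : n = 1 := by omega
    have hπ : π = 1 := Subsingleton.elim _ _
    constructor
    · intro _
      exact Equiv.Perm.isCycleOn_of_subsingleton _ _
    · intro _
      rw [hπ, fullCycleType]
      simp

/-- The number of elements of `K` which are at most `i`: the index of the block of positions
cut out by `K` that contains the (0-indexed) position `i`. -/
def blockIndex (K : Finset ℕ) (i : ℕ) : ℕ := (K.filter (· ≤ i)).card

theorem blockIndex_mono (K : Finset ℕ) : Monotone (blockIndex K) := fun _ _ h =>
  Finset.card_le_card (Finset.monotone_filter_right K fun _ _ hx => le_trans hx h)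

theorem blockIndex_succ_eq_iff (K : Finset ℕ) (i : ℕ) :
    blockIndex K (i + 1) = blockIndex K i ↔ i + 1 ∉ K := by
  have hsub : K.filter (· ≤ i) ⊆ K.filter (· ≤ i + 1) :=
    Finset.monotone_filter_right K fun _ _ hx => Nat.le_succ_of_le hx
  constructor
  · intro h hK
    have := Finset.eq_of_subset_of_card_le hsub h.le
    have hmem : i + 1 ∈ K.filter (· ≤ i) := this ▸ by simp [hK]
    simp at hmem
  · intro hK
    refine congrArg Finset.card (Finset.filter_congr fun x hx => ?_)
    have : x ≠ i + 1 := fun h => hK (h ▸ hx)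
    omega

theorem blockIndex_lt_card {K : Finset ℕ} {n i : ℕ} (hn : n ∈ K) (hi : i < n) :
    blockIndex K i < K.card :=
  Finset.card_lt_card (Finset.filter_ssubset.2 ⟨n, hn, by omega⟩)

theorem lt_blockIndex_iff {K : Finset ℕ} (j : Fin K.card) (i : ℕ) :
    j < blockIndex K i ↔ K.orderEmbOfFin rfl j ≤ i := by
  have hb : blockIndex K i = (Finset.univ.filter fun t => K.orderEmbOfFin rfl t ≤ i).card := by
    have hK : (Finset.univ : Finset (Fin K.card)).map (K.orderEmbOfFin rfl).toEmbedding = K :=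
      Finset.map_orderEmbOfFin_univ K rfl
    conv_lhs => rw [blockIndex, ← hK, Finset.filter_map, Finset.card_map]
    rfl
  rw [hb]
  constructor
  · intro h
    by_contra! hlt
    have hsub : (Finset.univ.filter fun t => K.orderEmbOfFin rfl t ≤ i) ⊆ Finset.Iio j := by
      intro t ht
      rw [Finset.mem_filter] at ht
      rw [Finset.mem_Iio, ← (K.orderEmbOfFin rfl).lt_iff_lt]
      omega
    have := Finset.card_le_card hsub
    rw [Fin.card_Iio] at this
    omega
  · intro h
    have hsub : Finset.Iic j ⊆ (Finset.univ.filter fun t => K.orderEmbOfFin rfl t ≤ i) := by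
      intro t ht
      rw [Finset.mem_Iic, ← (K.orderEmbOfFin rfl).le_iff_le] at ht
      simp only [Finset.mem_filter, Finset.mem_univ, true_and]
      omega
    have := Finset.card_le_card hsub
    rw [Fin.card_Iic] at this
    omega

/-- The block index of a position, as a map into `Fin K.card`. -/
def blockMap {K : Finset ℕ} {n : ℕ} (hn : n ∈ K) (i : Fin n) : Fin K.card :=
  ⟨blockIndex K i, blockIndex_lt_card hn i.2⟩

open Finset in
theorem comp_eq_ofFn {K : Finset ℕ} {n : ℕ} (hn : n ∈ K) (hK : K ⊆ Icc 1 n) :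
    comp K = List.ofFn fun j => #{x | blockMap hn x = j} := by
  have hlen : (comp K).length = K.card := by simp [comp]
  refine List.ext_getElem (by simp [hlen]) fun j h1 h2 => ?_
  have hj : j < K.card := hlen ▸ h1
  have hkn : K.orderEmbOfFin rfl ⟨j, hj⟩ ≤ n :=
    (mem_Icc.1 (hK (K.orderEmbOfFin_mem rfl ⟨j, hj⟩))).2
  have hfib : #{x | blockMap hn x = ⟨j, hj⟩} = #{x ∈ range n | blockIndex K x = j} := by
    rw [← card_map Fin.valEmbedding]
    congr 1
    ext x
    simp only [blockMap, Fin.mk.injEq, mem_map, mem_filter, mem_univ, true_and,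
      Fin.valEmbedding_apply, mem_range]
    exact ⟨fun ⟨y, hy, hyx⟩ => hyx ▸ ⟨y.2, hy⟩, fun h => ⟨⟨x, h.1⟩, h.2, rfl⟩⟩
  have hj' := fun i => lt_blockIndex_iff (⟨j, hj⟩ : Fin K.card) i
  rw [List.getElem_ofFn, hfib]
  simp only [comp, List.getElem_zipWith]
  rw [orderEmbOfFin_apply] at hkn
  simp only [orderEmbOfFin_apply] at hj'
  rcases j with _ | j
  · have : {x ∈ range n | blockIndex K x = 0} = range ((K.sort (· ≤ ·))[0]'(by simpa using hj)) := by
      ext x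
      have := hj' x
      simp only [mem_filter, mem_range] at this hkn ⊢
      simp only [Fin.getElem_fin] at this hkn
      omega
    rw [this]
    simp
  · have hj1 := fun i => lt_blockIndex_iff (⟨j, by omega⟩ : Fin K.card) i
    simp only [orderEmbOfFin_apply] at hj1
    have : {x ∈ range n | blockIndex K x = j + 1} =
        Ico ((K.sort (· ≤ ·))[j]'(by simp; omega)) ((K.sort (· ≤ ·))[j + 1]'(by simpa using hj)) := by
      ext x
      have h3 := hj' x
      have h4 := hj1 x
      simp only [mem_filter, mem_range, mem_Ico] at h3 h4 hkn ⊢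
      simp only [Fin.getElem_fin] at h3 h4 hkn
      omega
    rw [this]
    simp

theorem permVal_of_lt {n : ℕ} (π : Equiv.Perm (Fin n)) {i : ℕ} (h : i < n) :
    permVal n π i = π ⟨i, h⟩ := dif_pos h

theorem permVal_lt_of_descentSet_subset {n : ℕ} {π : Equiv.Perm (Fin n)} {K : Finset ℕ}
    (h : descentSet n π ⊆ K) {x y : ℕ} (hxy : x < y) (hy : y < n)
    (hb : blockIndex K x = blockIndex K y) : permVal n π x < permVal n π y := by
  induction y with
  | zero => omega
  | succ y ih =>
    have h1 := blockIndex_mono K (Nat.lt_succ_iff.1 hxy)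
    have h2 := blockIndex_mono K (Nat.le_succ y)
    have hK : y + 1 ∉ K := (blockIndex_succ_eq_iff K y).1 (by
      simp only [Nat.succ_eq_add_one] at h2
      omega)
    have hd : y + 1 ∉ descentSet n π := fun hd => hK (h hd)
    have hstep : permVal n π y < permVal n π (y + 1) := by
      have hne : permVal n π y ≠ permVal n π (y + 1) := by
        rw [permVal_of_lt π hy, permVal_of_lt π (Nat.lt_of_succ_lt hy)]
        intro he
        have := π.injective (Fin.ext he)
        simp at this
      simp only [descentSet, Finset.mem_insert, Finset.mem_filter, Finset.mem_Ico,
        Nat.add_sub_cancel, not_or, not_and, not_lt] at hd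
      exact lt_of_le_of_ne (hd.2 ⟨by omega, hy⟩) hne
    rcases Nat.lt_succ_iff_lt_or_eq.1 hxy with hlt | rfl
    · exact (ih hlt (by omega) (by simp only [Nat.succ_eq_add_one] at h2; omega)).trans hstep
    · exact hstep

theorem descentSet_subset_iff {n : ℕ} (π : Equiv.Perm (Fin n)) {K : Finset ℕ} (hn : n ∈ K) :
    descentSet n π ⊆ K ↔ ∀ i j, i < j → blockMap hn i = blockMap hn j → π i < π j := by
  constructor
  · intro h i j hij hb
    have := permVal_lt_of_descentSet_subset h hij j.2 (congrArg Fin.val hb)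
    rwa [permVal_of_lt π i.2, permVal_of_lt π j.2] at this
  · intro h i hi
    rw [descentSet, Finset.mem_insert, Finset.mem_filter, Finset.mem_Ico] at hi
    rcases hi with rfl | ⟨⟨h1, h2⟩, hlt⟩
    · exact hn
    · by_contra hK
      obtain ⟨i, rfl⟩ : ∃ t, i = t + 1 := ⟨i - 1, by omega⟩
      rw [Nat.add_sub_cancel, permVal_of_lt π h2, permVal_of_lt π (Nat.lt_of_succ_lt h2)] at hlt
      have := h ⟨i, by omega⟩ ⟨i + 1, h2⟩ (by simp)
        (Fin.ext ((blockIndex_succ_eq_iff K i).2 hK).symm)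
      exact lt_asymm hlt this

theorem dvd_foldr_gcd_iff (d : ℕ) (L : List ℕ) : d ∣ L.foldr Nat.gcd 0 ↔ ∀ r ∈ L, d ∣ r := by
  induction L with
  | nil => simp
  | cons r L ih => simp [Nat.dvd_gcd_iff, ih]

open Finset in
theorem Mq_ofFn {n a : ℕ} (r : Fin a → ℕ) (hr : ∑ i, r i = n) (hn : 0 < n) :
    Mq (List.ofFn r) = 1 / n * ∑ d ∈ n.divisors with ∀ i, d ∣ r i,
      (ArithmeticFunction.moebius d : ℚ) * ((n / d).factorial : ℚ) /
        ∏ i, ((r i / d).factorial : ℚ) := by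
  rw [Mq, List.sum_ofFn, hr]
  congr 1
  refine sum_congr ?_ fun d _ => ?_
  · ext d
    have h0 : Nat.gcd n ((List.ofFn r).foldr Nat.gcd 0) ≠ 0 := Nat.gcd_ne_zero_left hn.ne'
    simp only [Nat.mem_divisors, mem_filter, Nat.dvd_gcd_iff, dvd_foldr_gcd_iff,
      List.forall_mem_ofFn_iff]
    have hn0 : n ≠ 0 := hn.ne'
    tauto
  · rw [List.map_ofFn, List.prod_ofFn]
    rfl

open Finset in
theorem card_cycles_descentSet_subset {n : ℕ} (hn : 0 < n) {K : Finset ℕ} (hK : K ⊆ Icc 1 n)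
    (hnK : n ∈ K) :
    (Nat.card {π : Equiv.Perm (Fin n) // fullCycleType n π = {n} ∧ descentSet n π ⊆ K} : ℚ) =
      Mq (comp K) := by
  have : NeZero n := ⟨hn.ne'⟩
  have hmono : Monotone (blockMap hnK) := fun i j hij => blockIndex_mono K hij
  have hsum : ∑ j, #{x | blockMap hnK x = j} = n := by
    rw [← card_eq_sum_card_fiberwise fun _ _ => mem_coe.2 (mem_univ _), card_univ,
      Fintype.card_fin]
  rw [comp_eq_ofFn hnK hK, Mq_ofFn _ hsum hn, ← card_primitive_words _ hsum,
    ← card_isFiberwiseIncreasing _ hmono, card_isCycleOn_fiberwise_increasing]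
  simp_rw [fullCycleType_eq_singleton_iff hn, descentSet_subset_iff _ hnK]
  have : (n : ℚ) ≠ 0 := by positivity
  push_cast
  field_simp

open Finset in
theorem sum_neg_one_pow_card_sub_of_subset {α : Type*} [DecidableEq α] (D J : Finset α) :
    ∑ K ∈ J.powerset with D ⊆ K, (-1 : ℚ) ^ (#J - #K) = if D = J then 1 else 0 := by
  by_cases hDJ : D ⊆ J
  · have hset : {K ∈ J.powerset | D ⊆ K} = (J \ D).powerset.image (J \ ·) := by
      ext K
      simp only [mem_filter, mem_powerset, mem_image]
      constructor
      · rintro ⟨h1, h2⟩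
        exact ⟨J \ K, sdiff_subset_sdiff le_rfl h2, Finset.sdiff_sdiff_eq_self h1⟩
      · rintro ⟨L, hL, rfl⟩
        refine ⟨sdiff_subset, fun x hx => mem_sdiff.2 ⟨hDJ hx, fun hxL => ?_⟩⟩
        exact (mem_sdiff.1 (hL hxL)).2 hx
    rw [hset, sum_image]
    · have hz := sum_powerset_neg_one_pow_card (x := J \ D)
      have hterm : ∀ L ∈ (J \ D).powerset, (-1 : ℚ) ^ (#J - #(J \ L)) = (-1) ^ #L := by
        intro L hL
        have hLJ : L ⊆ J := (mem_powerset.1 hL).trans sdiff_subset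
        rw [card_sdiff_of_subset hLJ, Nat.sub_sub_self (card_le_card hLJ)]
      rw [sum_congr rfl hterm]
      have hz' : ∑ L ∈ (J \ D).powerset, (-1 : ℚ) ^ #L = if J \ D = ∅ then 1 else 0 := by
        exact_mod_cast congrArg (Int.cast : ℤ → ℚ) hz
      rw [hz']
      exact if_congr (sdiff_eq_empty_iff_subset.trans
        ⟨fun h => hDJ.antisymm h, fun h => h ▸ le_rfl⟩) rfl rfl
    · intro L hL L' hL' h
      have hL := (mem_powerset.1 (mem_coe.1 hL)).trans sdiff_subset
      have hL' := (mem_powerset.1 (mem_coe.1 hL')).trans sdiff_subset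
      have h : J \ L = J \ L' := h
      rw [← Finset.sdiff_sdiff_eq_self hL, h, Finset.sdiff_sdiff_eq_self hL']
  · rw [filter_false_of_mem fun K hK hDK => hDJ (hDK.trans (mem_powerset.1 hK)), sum_empty,
      if_neg fun h => hDJ h.le]

/-- The number of `n`-cycles with descent set equal to `J` (where `n ∈ J` by
convention, descent sets always containing `n`) is
`∑_{K ⊆ J, n ∈ K} (-1)^{|J| - |K|} M(C(K))`. -/
theorem stmt4 (n : ℕ) (hn : 0 < n) (J : Finset ℕ) (hJ : J ⊆ Finset.Icc 1 n)
    (hnJ : n ∈ J) :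
    (Nat.card {π : Equiv.Perm (Fin n) //
        fullCycleType n π = {n} ∧ descentSet n π = J} : ℚ) =
      ∑ K ∈ J.powerset.filter (fun K => n ∈ K),
        (-1 : ℚ) ^ (J.card - K.card) * Mq (comp K) := by
  have hcount (P : Equiv.Perm (Fin n) → Prop) [DecidablePred P] :
      (Nat.card {π : Equiv.Perm (Fin n) // fullCycleType n π = {n} ∧ P π} : ℚ) =
        ∑ π : Equiv.Perm (Fin n) with fullCycleType n π = {n}, if P π then (1 : ℚ) else 0 := by
    rw [Nat.card_eq_fintype_card, Fintype.card_subtype, ← Finset.filter_filter,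
      Finset.card_filter]
    push_cast
    rfl
  have hterm : ∀ K ∈ J.powerset.filter (fun K => n ∈ K),
      (-1 : ℚ) ^ (J.card - K.card) * Mq (comp K) =
        ∑ π : Equiv.Perm (Fin n) with fullCycleType n π = {n},
          if descentSet n π ⊆ K then (-1 : ℚ) ^ (J.card - K.card) else 0 := by
    intro K hK
    rw [Finset.mem_filter, Finset.mem_powerset] at hK
    rw [← card_cycles_descentSet_subset hn (hK.1.trans hJ) hK.2, hcount, Finset.mul_sum]
    simp
  rw [hcount, Finset.sum_congr rfl hterm, Finset.sum_comm]
  refine Finset.sum_congr rfl fun π _ => ?_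
  have hnπ : n ∈ descentSet n π := Finset.mem_insert_self _ _
  rw [← sum_neg_one_pow_card_sub_of_subset, ← Finset.sum_filter, Finset.filter_filter]
  refine Finset.sum_congr (Finset.filter_congr fun K _ => ?_) fun _ _ => rfl
  exact ⟨fun h => ⟨h hnπ, h⟩, fun h => h.2⟩
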